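/- arXiv:1405.0593 — 2 statements merged into one kernel-verified Lean document; each statement's English description precedes it below -/
import Mathlib

section
/- Let X_1,...,X_n be positive random variables such that X_1 is regularly varying with index -α for some α≥0, lim_{t→∞} P(X_i>t)/P(X_1>t)=λ_i ∈ [0,∞) for all i (so λ_1=1), and lim_{t→∞} P(X_i>t, X_j>t)/P(X_1>t)=0 for every pair i<j with λ_i>0 and λ_j>0. Let C=(C_1,...,C_n) be a random vector independent of (X_1,...,X_n) with C_1>0, E[C_1^β]<∞ for some β>α, and E[max_{2≤i≤n}|C_i|^γ] ∈ (0,∞) for some γ>α. Then, as t→∞, P(Σ_{i=1}^k C_i X_{i,n} > t) ~ Σ_{i=1}^n P(C_i X_{i,n} > t). -/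
open MeasureTheory ProbabilityTheory Filter Real

/-- `orderStat X i ω` is the `i`-th largest value among `X 0 ω, …, X (n-1) ω`
(decreasing rearrangement, so `orderStat X 0` is the maximum). -/
noncomputable def orderStat {Ω : Type*} {n : ℕ} (X : Fin n → Ω → ℝ) (i : Fin n) (ω : Ω) : ℝ :=
  ((Multiset.map (fun j => X j ω) (Finset.univ : Finset (Fin n)).val).sort (· ≤ ·)).getD
    (n - 1 - (i : ℕ)) 0

theorem le_two_mul_rpow_mul_of_doubling {F : ℝ → ℝ} (hF : Antitone F) {γ t₀ : ℝ} (hγ : 0 ≤ γ)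
    (ht₀ : 0 < t₀) (h : ∀ s, t₀ ≤ s → F s ≤ 2 ^ γ * F (s * 2)) (hF0 : ∀ s, 0 ≤ F s)
    {s c : ℝ} (hs : t₀ ≤ s) (hc : 1 ≤ c) : F s ≤ (2 * c) ^ γ * F (s * c) := by
  have iter : ∀ m : ℕ, F s ≤ ((2 : ℝ) ^ m) ^ γ * F (s * 2 ^ m) := by
    intro m
    induction m with
    | zero => simp
    | succ m ih =>
      have h2 : (1 : ℝ) ≤ 2 ^ m := one_le_pow₀ (by norm_num)
      have h3 := h (s * 2 ^ m) (hs.trans (le_mul_of_one_le_right (ht₀.le.trans hs) h2))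
      calc F s ≤ _ := ih
        _ ≤ ((2 : ℝ) ^ m) ^ γ * (2 ^ γ * F (s * 2 ^ m * 2)) := by gcongr
        _ = _ := by
          rw [pow_succ, Real.mul_rpow (by positivity) (by norm_num), ← mul_assoc, ← mul_assoc s]
  obtain ⟨m, hm, hm'⟩ := exists_nat_pow_near hc (one_lt_two (α := ℝ))
  have hs0 : 0 ≤ s := ht₀.le.trans hs
  calc F s ≤ _ := iter (m + 1)
    _ ≤ (2 * c) ^ γ * F (s * c) := by
      have h1 : (2 : ℝ) ^ (m + 1) ≤ 2 * c := by rw [pow_succ]; linarith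
      have h2 : F (s * 2 ^ (m + 1)) ≤ F (s * c) := hF (by gcongr)
      have := hF0 (s * 2 ^ (m + 1))
      gcongr

/-- Eventually a regularly varying tail is positive. -/
theorem eventually_pos_of_tendsto_div {F : ℝ → ℝ} (hF0 : ∀ s, 0 ≤ F s) {α : ℝ}
    (hreg : ∀ x : ℝ, 0 < x → Tendsto (fun t => F (t * x) / F t) atTop (nhds (x ^ (-α)))) :
    ∀ᶠ t in atTop, 0 < F t := by
  have h := hreg 1 one_pos
  rw [Real.one_rpow] at h
  filter_upwards [h.eventually_ne one_ne_zero] with t ht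
  exact (hF0 t).lt_of_ne fun h0 => ht (by simp [← h0])

/-- A tail `G` which is of the order of a regularly varying tail `F` satisfies a Potter-type bound
which is uniform in the scaling factor. -/
theorem exists_potter_bound {F G : ℝ → ℝ} (hF : Antitone F) (hF0 : ∀ s, 0 ≤ F s)
    (hG : Antitone G) (hG1 : ∀ s, G s ≤ 1) {α γ L : ℝ} (hα : 0 ≤ α) (hγ : α < γ)
    (hreg : ∀ x : ℝ, 0 < x → Tendsto (fun t => F (t * x) / F t) atTop (nhds (x ^ (-α))))
    (hGF : Tendsto (fun t => G t / F t) atTop (nhds L)) :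
    ∃ K, ∀ᶠ t in atTop, ∀ c, 0 < c → G (t / c) / F t ≤ K * (1 + c ^ γ) := by
  have hpos := eventually_pos_of_tendsto_div hF0 hreg
  have hdouble : ∀ᶠ s in atTop, F s ≤ 2 ^ γ * F (s * 2) := by
    have hlt : (2 : ℝ) ^ (-γ) < 2 ^ (-α) :=
      Real.rpow_lt_rpow_of_exponent_lt one_lt_two (neg_lt_neg hγ)
    filter_upwards [(hreg 2 two_pos).eventually_const_lt hlt, hpos] with s h hs
    rw [lt_div_iff₀ hs, Real.rpow_neg two_pos.le, inv_mul_lt_iff₀ (by positivity)] at h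
    exact h.le
  obtain ⟨A, hA, hbd⟩ : ∃ A > 0, ∀ᶠ t in atTop, G t ≤ A * F t := by
    have hlt : L < |L| + 1 := (le_abs_self L).trans_lt (lt_add_one _)
    refine ⟨|L| + 1, by positivity, ?_⟩
    filter_upwards [hGF.eventually_lt_const hlt, hpos] with t h ht
    exact ((div_lt_iff₀ ht).1 h).le
  obtain ⟨t₀, ht₀⟩ := eventually_atTop.1
    ((hpos.and (hdouble.and hbd)).and (eventually_gt_atTop (0 : ℝ)))
  have ht₀pos : 0 < t₀ := (ht₀ t₀ le_rfl).2
  have hγ0 : 0 ≤ γ := hα.trans hγ.le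
  have potter {s c : ℝ} (hs : t₀ ≤ s) (hc : 1 ≤ c) : F s ≤ (2 * c) ^ γ * F (s * c) :=
    le_two_mul_rpow_mul_of_doubling hF hγ0 ht₀pos (fun s hs => (ht₀ s hs).1.2.1) hF0 hs hc
  have hFt₀ : 0 < F t₀ := (ht₀ t₀ le_rfl).1.1
  refine ⟨(A + 1 / F t₀) * 2 ^ γ, ?_⟩
  filter_upwards [eventually_ge_atTop t₀] with t ht c hc
  have htpos : 0 < t := ht₀pos.trans_le ht
  have hFt := (ht₀ t ht).1.1
  have h2γ : (1 : ℝ) ≤ 2 ^ γ := Real.one_le_rpow one_le_two hγ0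
  have hcγ : 0 < c ^ γ := Real.rpow_pos_of_pos hc γ
  have hinv : 0 < 1 / F t₀ := by positivity
  rw [div_le_iff₀ hFt]
  rcases le_total c 1 with hc1 | hc1
  · calc G (t / c) ≤ G t := hG (le_div_self htpos.le hc hc1)
      _ ≤ A * 1 * 1 * F t := by simpa using (ht₀ t ht).1.2.2
      _ ≤ _ := by gcongr <;> linarith
  rcases le_total t₀ (t / c) with htc | htc
  · calc G (t / c) ≤ A * F (t / c) := (ht₀ _ htc).1.2.2
      _ ≤ A * ((2 * c) ^ γ * F (t / c * c)) := by gcongr; exact potter htc hc1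
      _ = A * 2 ^ γ * c ^ γ * F t := by
        rw [div_mul_cancel₀ _ hc.ne', Real.mul_rpow two_pos.le hc.le]; ring
      _ ≤ _ := by gcongr <;> linarith
  · have h1 : t / t₀ ≤ c := by
      rw [div_le_iff₀ hc] at htc
      rw [div_le_iff₀ ht₀pos]; linarith
    have h2 := potter le_rfl ((one_le_div ht₀pos).2 ht)
    rw [mul_div_cancel₀ _ ht₀pos.ne'] at h2
    calc G (t / c) ≤ 1 := hG1 _
      _ = 1 / F t₀ * F t₀ := by field_simp
      _ ≤ 1 / F t₀ * ((2 * (t / t₀)) ^ γ * F t) := by gcongr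
      _ ≤ 1 / F t₀ * ((2 * c) ^ γ * F t) := by gcongr
      _ = 1 / F t₀ * 2 ^ γ * c ^ γ * F t := by
        rw [Real.mul_rpow two_pos.le hc.le]; ring
      _ ≤ _ := by gcongr <;> linarith

theorem measureReal_mul_gt_eq_integral {Ω : Type*} [MeasurableSpace Ω] {P : Measure Ω}
    [IsProbabilityMeasure P] {D Z : Ω → ℝ} (hD : Measurable D) (hZ : Measurable Z)
    (hD0 : ∀ ω, 0 < D ω) (hind : IndepFun D Z P) (t : ℝ) :
    P.real {ω | D ω * Z ω > t} = ∫ ω, P.real {ω' | Z ω' > t / D ω} ∂P := by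
  have hset : MeasurableSet {p : ℝ × ℝ | p.1 * p.2 > t} :=
    measurableSet_lt measurable_const (measurable_fst.mul measurable_snd)
  have hanti : Antitone fun s => P {ω' | Z ω' > s} := fun s s' h =>
    measure_mono fun ω (hω : _ < _) => lt_of_le_of_lt h hω
  have hmap := (indepFun_iff_map_prod_eq_prod_map_map hD.aemeasurable hZ.aemeasurable).1 hind
  have := Measure.isProbabilityMeasure_map (μ := P) hZ.aemeasurable
  have key : P {ω | D ω * Z ω > t} = ∫⁻ ω, P {ω' | Z ω' > t / D ω} ∂P := by
    have h1 : P {ω | D ω * Z ω > t} =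
        (P.map fun ω => (D ω, Z ω)) {p : ℝ × ℝ | p.1 * p.2 > t} := by
      rw [Measure.map_apply (hD.prodMk hZ) hset]; rfl
    rw [h1, hmap, Measure.prod_apply hset,
      lintegral_map (measurable_measure_prodMk_left hset) hD]
    refine lintegral_congr fun ω => ?_
    rw [Measure.map_apply hZ (measurable_prodMk_left hset)]
    congr 1
    ext ω'
    simp [div_lt_iff₀' (hD0 ω)]
  rw [measureReal_def, key]
  exact (integral_toReal (hanti.measurable.comp (measurable_const.div hD)).aemeasurable
    (ae_of_all _ fun ω => measure_lt_top _ _)).symm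

/-- Breiman's lemma: multiplying by an independent positive weight with a moment of order larger
than the index of regular variation scales the tail by the moment of the order of that index. -/
theorem tendsto_measureReal_mul_div {Ω : Type*} [MeasurableSpace Ω] {P : Measure Ω}
    [IsProbabilityMeasure P] {F : ℝ → ℝ} (hF : Antitone F) (hF0 : ∀ s, 0 ≤ F s)
    {α γ L : ℝ} (hα : 0 ≤ α) (hγ : α < γ)
    (hreg : ∀ x : ℝ, 0 < x → Tendsto (fun t => F (t * x) / F t) atTop (nhds (x ^ (-α))))
    {D Z : Ω → ℝ} (hD : Measurable D) (hZ : Measurable Z)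
    (hD0 : ∀ ω, 0 < D ω) (hind : IndepFun D Z P) (hint : Integrable (fun ω => D ω ^ γ) P)
    (hZF : Tendsto (fun t => P.real {ω | Z ω > t} / F t) atTop (nhds L)) :
    Tendsto (fun t => P.real {ω | D ω * Z ω > t} / F t) atTop
      (nhds (L * ∫ ω, D ω ^ α ∂P)) := by
  have hanti : Antitone fun s => P.real {ω' | Z ω' > s} := fun s s' h =>
    measureReal_mono fun ω (hω : _ < _) => lt_of_le_of_lt h hω
  obtain ⟨K, hK⟩ := exists_potter_bound hF hF0 hanti (fun _ => measureReal_le_one) hα hγ hreg hZF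
  simp only [measureReal_mul_gt_eq_integral hD hZ hD0 hind, ← integral_div, ← integral_const_mul]
  refine tendsto_integral_filter_of_dominated_convergence (fun ω => K * (1 + D ω ^ γ))
    (Eventually.of_forall fun t =>
      ((hanti.measurable.comp (measurable_const.div hD)).div_const _).aestronglyMeasurable)
    ?_ (((integrable_const 1).add hint).const_mul K) (ae_of_all _ fun ω => ?_)
  · filter_upwards [hK] with t ht
    refine ae_of_all _ fun ω => ?_
    rw [Real.norm_of_nonneg (div_nonneg measureReal_nonneg (hF0 t))]
    exact ht _ (hD0 ω)
  · have hscale : Tendsto (fun t => t / D ω) atTop atTop := tendsto_id.atTop_div_const (hD0 ω)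
    have h := (hZF.comp hscale).mul (hreg (D ω)⁻¹ (inv_pos.2 (hD0 ω)))
    rw [Real.inv_rpow (hD0 ω).le, Real.rpow_neg (hD0 ω).le, inv_inv] at h
    refine h.congr' ?_
    filter_upwards [hscale.eventually (eventually_pos_of_tendsto_div hF0 hreg)] with t ht
    simp only [Function.comp_apply, ← div_eq_mul_inv]
    field_simp

theorem orderStat_eq_sort {Ω : Type*} {n : ℕ} (X : Fin n → Ω → ℝ) (i : Fin n) (ω : Ω) :
    orderStat X i ω = X (Tuple.sort (fun j => X j ω) i.rev) ω := by
  have hn := i.pos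
  set f : Fin n → ℝ := fun j => X j ω
  have hlist : (Multiset.map f (Finset.univ : Finset (Fin n)).val).sort (· ≤ ·) =
      List.ofFn (f ∘ Tuple.sort f) := by
    refine List.Perm.eq_of_pairwise' (r := (· ≤ ·)) (Multiset.pairwise_sort _ _)
      (Tuple.monotone_sort f).sortedLE_ofFn.pairwise ?_
    rw [← Multiset.coe_eq_coe, Multiset.sort_eq,
      Multiset.coe_eq_coe.2 (Equiv.Perm.ofFn_comp_perm (Tuple.sort f) f), Fin.univ_val_map]
  have hi : n - 1 - (i : ℕ) = (i.rev : ℕ) := by rw [Fin.val_rev]; omega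
  rw [orderStat, hlist, hi, List.getD_eq_getElem _ _ (by simpa using hn), List.getElem_ofFn]
  rfl

theorem orderStat_zero {Ω : Type*} {n : ℕ} (X : Fin (n + 1) → Ω → ℝ) (ω : Ω) :
    orderStat X 0 ω = ⨆ i, X i ω := by
  rw [orderStat_eq_sort]
  refine le_antisymm (le_ciSup (f := fun i => X i ω) (Finite.bddAbove_range _) _)
    (ciSup_le fun i => ?_)
  have h := Tuple.monotone_sort (fun j => X j ω)
    (Fin.le_last ((Tuple.sort fun j => X j ω).symm i))
  simpa using h

/-- Every order statistic except the largest is attained simultaneously by two coordinates. -/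
theorem orderStat_le_iSup_min {Ω : Type*} {n : ℕ} (X : Fin (n + 1) → Ω → ℝ) {i : Fin (n + 1)}
    (hi : i ≠ 0) (ω : Ω) :
    orderStat X i ω ≤
      ⨆ p : Fin (n + 1) × Fin (n + 1), if p.1 < p.2 then min (X p.1 ω) (X p.2 ω) else 0 := by
  rw [orderStat_eq_sort]
  set σ := Tuple.sort fun j => X j ω
  have hle : X (σ i.rev) ω ≤ X (σ (Fin.last n)) ω :=
    Tuple.monotone_sort (fun j => X j ω) (Fin.le_last i.rev)
  have hne : σ i.rev ≠ σ (Fin.last n) := by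
    rw [σ.injective.ne_iff, ← Fin.rev_zero, Fin.rev_injective.ne_iff]
    exact hi
  have hbdd : BddAbove (Set.range fun p : Fin (n + 1) × Fin (n + 1) =>
    if p.1 < p.2 then min (X p.1 ω) (X p.2 ω) else 0) := Finite.bddAbove_range _
  rcases hne.lt_or_gt with h | h
  · exact (by simp [h, hle] : X (σ i.rev) ω = _).le.trans
      (le_ciSup hbdd (σ i.rev, σ (Fin.last n)))
  · exact (by simp [h, hle] : X (σ i.rev) ω = _).le.trans
      (le_ciSup hbdd (σ (Fin.last n), σ i.rev))

theorem setOf_iSup_gt {Ω ι : Type*} [Finite ι] [Nonempty ι] (X : ι → Ω → ℝ) (t : ℝ) :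
    {ω | ⨆ i, X i ω > t} = ⋃ i, {ω | X i ω > t} := by
  ext ω
  simp [lt_ciSup_iff (Finite.bddAbove_range fun i => X i ω)]

theorem tendsto_measureReal_iSup_min_div {Ω ι : Type*} [MeasurableSpace Ω] {P : Measure Ω}
    [IsProbabilityMeasure P] [Fintype ι] [Nonempty ι] [LinearOrder ι] {X : ι → Ω → ℝ} {F : ℝ → ℝ}
    (hF0 : ∀ s, 0 ≤ F s) {lam : ι → ℝ} (hlam_nonneg : ∀ i, 0 ≤ lam i)
    (hlam : ∀ i, Tendsto (fun t => P.real {ω | X i ω > t} / F t) atTop (nhds (lam i)))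
    (hjoint : ∀ i j, i < j → 0 < lam i → 0 < lam j →
      Tendsto (fun t => P.real {ω | X i ω > t ∧ X j ω > t} / F t) atTop (nhds 0)) :
    Tendsto (fun t => P.real {ω | (⨆ p : ι × ι,
      if p.1 < p.2 then min (X p.1 ω) (X p.2 ω) else 0) > t} / F t) atTop (nhds 0) := by
  have hpair (p : ι × ι) : Tendsto (fun t =>
      P.real {ω | (if p.1 < p.2 then min (X p.1 ω) (X p.2 ω) else 0) > t} / F t)
      atTop (nhds 0) := by
    by_cases hp : p.1 < p.2
    · simp only [hp, if_true, gt_iff_lt, lt_min_iff]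
      have of_zero (i : ι) (hi : p.1 = i ∨ p.2 = i) (h0 : lam i = 0) :
          Tendsto (fun t => P.real {ω | t < X p.1 ω ∧ t < X p.2 ω} / F t) atTop (nhds 0) := by
        refine squeeze_zero (fun t => div_nonneg measureReal_nonneg (hF0 t)) (fun t => ?_)
          (h0 ▸ hlam i)
        refine div_le_div_of_nonneg_right (measureReal_mono fun ω hω => ?_) (hF0 t)
        rcases hi with rfl | rfl
        exacts [hω.1, hω.2]
      rcases (hlam_nonneg p.1).eq_or_lt with h1 | h1
      · exact of_zero _ (Or.inl rfl) h1.symm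
      rcases (hlam_nonneg p.2).eq_or_lt with h2 | h2
      · exact of_zero _ (Or.inr rfl) h2.symm
      exact hjoint _ _ hp h1 h2
    · refine tendsto_const_nhds.congr' ?_
      filter_upwards [eventually_ge_atTop 0] with t ht
      simp [hp, ht.not_gt]
  refine squeeze_zero (fun t => div_nonneg measureReal_nonneg (hF0 t)) (fun t => ?_)
    (by simpa using tendsto_finsetSum Finset.univ fun p _ => hpair p)
  rw [← Finset.sum_div, setOf_iSup_gt]
  exact div_le_div_of_nonneg_right (measureReal_iUnion_fintype_le _) (hF0 t)

theorem tendsto_measureReal_iSup_div {Ω ι : Type*} [MeasurableSpace Ω] {P : Measure Ω}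
    [IsProbabilityMeasure P] [Fintype ι] [Nonempty ι] [LinearOrder ι] {X : ι → Ω → ℝ} {F : ℝ → ℝ}
    (hX : ∀ i, Measurable (X i)) (hF0 : ∀ s, 0 ≤ F s) {lam : ι → ℝ}
    (hlam : ∀ i, Tendsto (fun t => P.real {ω | X i ω > t} / F t) atTop (nhds (lam i)))
    (hmin : Tendsto (fun t => P.real {ω | (⨆ p : ι × ι,
      if p.1 < p.2 then min (X p.1 ω) (X p.2 ω) else 0) > t} / F t) atTop (nhds 0)) :
    Tendsto (fun t => P.real {ω | (⨆ i, X i ω) > t} / F t) atTop (nhds (∑ i, lam i)) := by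
  have hsum := tendsto_finsetSum Finset.univ fun i (_ : i ∈ Finset.univ) => hlam i
  have hlow := hsum.sub (hmin.const_mul (Fintype.card ι : ℝ))
  rw [mul_zero, sub_zero] at hlow
  refine tendsto_of_tendsto_of_tendsto_of_le_of_le hlow hsum (fun t => ?_) (fun t => ?_)
  · set B := {ω | (⨆ p : ι × ι, if p.1 < p.2 then min (X p.1 ω) (X p.2 ω) else 0) > t} with hB
    have hBmeas : MeasurableSet B := measurableSet_lt measurable_const <| Measurable.iSup fun p => by
      split_ifs
      exacts [(hX _).min (hX _), measurable_const]
    have hlt {i j : ι} (hij : i < j) {ω : Ω} (hi : X i ω > t) (hj : X j ω > t) : ω ∈ B := by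
      rw [hB, setOf_iSup_gt]
      exact Set.mem_iUnion.2 ⟨(i, j), by simp [hij, hi, hj]⟩
    have hdisj : Pairwise (Function.onFun Disjoint fun i => {ω | X i ω > t} \ B) := by
      intro i j hij
      refine Set.disjoint_left.2 fun ω hi hj => hi.2 ?_
      rcases hij.lt_or_gt with h | h
      exacts [hlt h hi.1 hj.1, hlt h hj.1 hi.1]
    have hunion := measureReal_iUnion_fintype (μ := P) hdisj
      fun i => (measurableSet_lt measurable_const (hX i)).diff hBmeas
    have hle : ∑ i, P.real {ω | X i ω > t} ≤
        P.real {ω | (⨆ i, X i ω) > t} + Fintype.card ι * P.real B :=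
      calc ∑ i, P.real {ω | X i ω > t} ≤ ∑ i, (P.real ({ω | X i ω > t} \ B) + P.real B) := by
            refine Finset.sum_le_sum fun i _ => (measureReal_mono ?_).trans (measureReal_union_le _ _)
            rw [Set.sdiff_union_self]
            exact Set.subset_union_left
        _ = P.real (⋃ i, {ω | X i ω > t} \ B) + Fintype.card ι * P.real B := by
            rw [Finset.sum_add_distrib, hunion]; simp
        _ ≤ _ := by
            rw [setOf_iSup_gt]
            exact add_le_add_left
              (measureReal_mono (Set.iUnion_mono fun i => Set.sdiff_subset)) _
    rw [← Finset.sum_div, ← mul_div_assoc, ← sub_div]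
    exact div_le_div_of_nonneg_right (by linarith) (hF0 t)
  · rw [← Finset.sum_div, setOf_iSup_gt]
    exact div_le_div_of_nonneg_right (measureReal_iUnion_fintype_le _) (hF0 t)

/-- Perturbing a regularly varying tail by a remainder with negligible tail does not change its
asymptotics. -/
theorem tendsto_measureReal_add_div {Ω : Type*} [MeasurableSpace Ω] {P : Measure Ω}
    [IsProbabilityMeasure P] {F : ℝ → ℝ} (hF0 : ∀ s, 0 ≤ F s) {α L : ℝ}
    (hpos : ∀ᶠ t in atTop, 0 < F t)
    (hreg : ∀ x : ℝ, 0 < x → Tendsto (fun t => F (t * x) / F t) atTop (nhds (x ^ (-α))))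
    {Y R S : Ω → ℝ} (hR : ∀ ω, |S ω - Y ω| ≤ R ω)
    (hYF : Tendsto (fun t => P.real {ω | Y ω > t} / F t) atTop (nhds L))
    (hRF : Tendsto (fun t => P.real {ω | R ω > t} / F t) atTop (nhds 0)) :
    Tendsto (fun t => P.real {ω | S ω > t} / F t) atTop (nhds L) := by
  have scale {V : Ω → ℝ} {l : ℝ} (h : Tendsto (fun t => P.real {ω | V ω > t} / F t) atTop (nhds l))
      {x : ℝ} (hx : 0 < x) :
      Tendsto (fun t => P.real {ω | V ω > t * x} / F t) atTop (nhds (l * x ^ (-α))) := by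
    have hscale : Tendsto (fun t => t * x) atTop atTop := tendsto_id.atTop_mul_const hx
    refine ((h.comp hscale).mul (hreg x hx)).congr' ?_
    filter_upwards [hscale.eventually hpos] with t ht
    simp only [Function.comp_apply]
    field_simp
  have hcont : Tendsto (fun x : ℝ => L * x ^ (-α)) (nhds 1) (nhds L) := by
    have h := (Real.continuousAt_rpow_const 1 (-α) (Or.inl one_ne_zero)).tendsto.const_mul L
    simpa using h
  have hleft : Tendsto (fun ε : ℝ => 1 - ε) (nhdsWithin 0 (Set.Ioi 0)) (nhds 1) := by
    simpa using (tendsto_const_nhds (x := (1 : ℝ))).sub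
      (tendsto_id.mono_left nhdsWithin_le_nhds : Tendsto id (nhdsWithin (0 : ℝ) (Set.Ioi 0)) _)
  have hright : Tendsto (fun ε : ℝ => 1 + ε) (nhdsWithin 0 (Set.Ioi 0)) (nhds 1) := by
    simpa using (tendsto_const_nhds (x := (1 : ℝ))).add
      (tendsto_id.mono_left nhdsWithin_le_nhds : Tendsto id (nhdsWithin (0 : ℝ) (Set.Ioi 0)) _)
  refine tendsto_order.2 ⟨fun a ha => ?_, fun a ha => ?_⟩
  · obtain ⟨ε, hεa, hε⟩ := (((hcont.comp hright).eventually_const_lt ha).and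
      self_mem_nhdsWithin).exists
    have hε0 : 0 < ε := hε
    have h := (scale hYF (by linarith : 0 < 1 + ε)).sub (scale hRF hε0)
    rw [zero_mul, sub_zero] at h
    filter_upwards [h.eventually_const_lt hεa] with t ht
    refine ht.trans_le ?_
    rw [← sub_div]
    refine div_le_div_of_nonneg_right (sub_le_iff_le_add.2 ?_) (hF0 t)
    refine (measureReal_mono fun ω hω => ?_).trans (measureReal_union_le _ _)
    by_contra hcon
    simp only [Set.mem_union, Set.mem_ofPred_eq, not_or, not_lt, gt_iff_lt] at hcon hω
    linarith [neg_abs_le (S ω - Y ω), hR ω]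
  · obtain ⟨ε, ⟨hεa, hε1⟩, hε⟩ := ((((hcont.comp hleft).eventually_lt_const ha).and
      (hleft.eventually_const_lt one_pos)).and self_mem_nhdsWithin).exists
    have hε0 : 0 < ε := hε
    have h := (scale hYF hε1).add (scale hRF hε0)
    rw [zero_mul, add_zero] at h
    filter_upwards [h.eventually_lt_const hεa] with t ht
    refine lt_of_le_of_lt ?_ ht
    rw [← add_div]
    refine div_le_div_of_nonneg_right ?_ (hF0 t)
    refine (measureReal_mono fun ω hω => ?_).trans (measureReal_union_le _ _)
    by_contra hcon
    simp only [Set.mem_union, Set.mem_ofPred_eq, not_or, not_lt, gt_iff_lt] at hcon hω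
    linarith [le_abs_self (S ω - Y ω), hR ω]

/-- Theorem 2 (weights independent of the risks): tail asymptotics of a randomly
weighted sum of the top `k` order statistics, regular variation index `α ≥ 0`. -/
theorem randomly_weighted_order_statistics_sum_representation
    {Ω : Type*} [MeasureSpace Ω] [IsProbabilityMeasure (ℙ : Measure Ω)]
    (n k : ℕ) (hk : 1 ≤ k) (hkn : k ≤ n + 1)
    (X : Fin (n + 1) → Ω → ℝ) (hXmeas : ∀ i, Measurable (X i))
    (hXpos : ∀ i ω, 0 < X i ω)
    (α : ℝ) (hα : 0 ≤ α)
    (hreg : ∀ x : ℝ, 0 < x →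
      Tendsto (fun t : ℝ =>
        (ℙ {ω | X 0 ω > t * x}).toReal / (ℙ {ω | X 0 ω > t}).toReal) atTop (nhds (x ^ (-α))))
    (lam : Fin (n + 1) → ℝ) (hlam_nonneg : ∀ i, 0 ≤ lam i) (hlam0 : lam 0 = 1)
    (hlam : ∀ i, Tendsto (fun t : ℝ =>
        (ℙ {ω | X i ω > t}).toReal / (ℙ {ω | X 0 ω > t}).toReal) atTop (nhds (lam i)))
    (hjoint : ∀ i j : Fin (n + 1), i < j → 0 < lam i → 0 < lam j →
      Tendsto (fun t : ℝ =>
        (ℙ {ω | X i ω > t ∧ X j ω > t}).toReal / (ℙ {ω | X 0 ω > t}).toReal) atTop (nhds 0))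
    (C : Fin (n + 1) → Ω → ℝ) (hCmeas : ∀ i, Measurable (C i))
    (hC1pos : ∀ ω, 0 < C 0 ω)
    (hindep : IndepFun (fun ω i => C i ω) (fun ω i => X i ω) ℙ)
    (β : ℝ) (hβ : α < β)
    (hmom : Integrable (fun ω => C 0 ω ^ β) ℙ)
    (Ct : Ω → ℝ) (hCt : ∀ ω, Ct ω = ⨆ i : Fin (n + 1), if i = 0 then 0 else |C i ω|)
    (γ : ℝ) (hγ : α < γ)
    (hCtmom : Integrable (fun ω => Ct ω ^ γ) ℙ)
    (hCtpos : 0 < ∫ ω, Ct ω ^ γ ∂ℙ) :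
    Tendsto (fun t : ℝ =>
        (ℙ {ω | ∑ i ∈ Finset.univ.filter (fun i : Fin (n + 1) => (i : ℕ) < k),
            C i ω * orderStat X i ω > t}).toReal /
          (∑ i : Fin (n + 1), (ℙ {ω | C i ω * orderStat X i ω > t}).toReal)) atTop (nhds 1) := by
  have hF : Antitone fun t => (ℙ : Measure Ω).real {ω | X 0 ω > t} := fun s s' h =>
    measureReal_mono fun ω (hω : _ < _) => lt_of_le_of_lt h hω
  have hF0 (s : ℝ) : 0 ≤ (ℙ : Measure Ω).real {ω | X 0 ω > s} := measureReal_nonneg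
  have hpos := eventually_pos_of_tendsto_div hF0 hreg
  set M : Ω → ℝ := fun ω => ⨆ i, X i ω with hM
  set Z : Ω → ℝ := fun ω => ⨆ p : Fin (n + 1) × Fin (n + 1),
    if p.1 < p.2 then min (X p.1 ω) (X p.2 ω) else 0
  set D : Ω → ℝ := fun ω => (n + 1) * max (Ct ω) 1 with hD
  have hmeasM : Measurable fun x : Fin (n + 1) → ℝ => ⨆ i, x i := Measurable.iSup measurable_pi_apply
  have hmeasZ : Measurable fun x : Fin (n + 1) → ℝ =>
      ⨆ p : Fin (n + 1) × Fin (n + 1), if p.1 < p.2 then min (x p.1) (x p.2) else 0 :=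
    Measurable.iSup fun p => by split_ifs <;> fun_prop
  have hmeasCt : Measurable fun c : Fin (n + 1) → ℝ =>
      ⨆ i : Fin (n + 1), if i = 0 then 0 else |c i| :=
    Measurable.iSup fun i => by
      split_ifs
      exacts [measurable_const, (measurable_pi_apply i).abs]
  have hmeasD : Measurable fun c : Fin (n + 1) → ℝ =>
      ((n : ℝ) + 1) * max (⨆ i : Fin (n + 1), if i = 0 then 0 else |c i|) 1 :=
    (hmeasCt.max measurable_const).const_mul _
  have hXvec : Measurable fun ω i => X i ω := measurable_pi_lambda _ hXmeas
  have hCvec : Measurable fun ω i => C i ω := measurable_pi_lambda _ hCmeas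
  have hDeq : D = (fun c : Fin (n + 1) → ℝ =>
      ((n : ℝ) + 1) * max (⨆ i : Fin (n + 1), if i = 0 then 0 else |c i|) 1) ∘
        fun ω i => C i ω := by
    funext ω
    simp [hD, hCt]
  have hMmeas : Measurable M := hmeasM.comp hXvec
  have hZmeas : Measurable Z := hmeasZ.comp hXvec
  have hindC : IndepFun (C 0) M ℙ := hindep.comp (measurable_pi_apply 0) hmeasM
  have hindD : IndepFun D Z ℙ := hDeq ▸ hindep.comp hmeasD hmeasZ
  have hDmeas : Measurable D := hDeq ▸ hmeasD.comp hCvec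
  have hCt0 (ω : Ω) : 0 ≤ Ct ω := by
    rw [hCt]
    exact Real.iSup_nonneg fun i => by split_ifs <;> positivity
  have hDpos (ω : Ω) : 0 < D ω := mul_pos (by positivity) (lt_max_of_lt_right one_pos)
  have hDint : Integrable (fun ω => D ω ^ γ) ℙ := by
    have hγ0 : 0 ≤ γ := hα.trans hγ.le
    refine (((integrable_const 1).add hCtmom).const_mul (((n : ℝ) + 1) ^ γ)).mono'
      (hDmeas.pow_const γ).aestronglyMeasurable (ae_of_all _ fun ω => ?_)
    rw [Real.norm_of_nonneg (Real.rpow_nonneg (hDpos ω).le _), hD,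
      Real.mul_rpow (by positivity) (zero_le_one.trans (le_max_right _ _))]
    refine mul_le_mul_of_nonneg_left ?_ (by positivity)
    have h0 := Real.rpow_nonneg (hCt0 ω) γ
    simp only [Pi.add_apply]
    rcases max_cases (Ct ω) 1 with ⟨h, -⟩ | ⟨h, -⟩ <;> rw [h]
    · linarith
    · rw [Real.one_rpow]; linarith
  have hZF := tendsto_measureReal_iSup_min_div hF0 hlam_nonneg hlam hjoint
  have hMF := tendsto_measureReal_iSup_div hXmeas hF0 hlam hZF
  have hDZ := tendsto_measureReal_mul_div hF hF0 hα hγ hreg hDmeas hZmeas hDpos hindD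
    hDint hZF
  rw [zero_mul] at hDZ
  have hCM := tendsto_measureReal_mul_div hF hF0 hα hβ hreg (hCmeas 0) hMmeas hC1pos hindC hmom hMF
  simp only [hM, ← orderStat_zero] at hCM
  set L := (∑ i, lam i) * ∫ ω, C 0 ω ^ α
  have hLpos : 0 < L := by
    refine mul_pos ?_ ?_
    · exact (hlam0 ▸ one_pos).trans_le
        (Finset.single_le_sum (fun i _ => hlam_nonneg i) (Finset.mem_univ 0))
    · have hsupp : Function.support (fun ω => C 0 ω ^ α) = Set.univ :=
        Function.support_eq_univ fun ω => (Real.rpow_pos_of_pos (hC1pos ω) α).ne'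
      rw [integral_pos_iff_support_of_nonneg (fun ω => Real.rpow_nonneg (hC1pos ω).le α), hsupp]
      · simp
      · refine ((integrable_const 1).add hmom).mono'
          ((hCmeas 0).pow_const α).aestronglyMeasurable (ae_of_all _ fun ω => ?_)
        rw [Real.norm_of_nonneg (Real.rpow_nonneg (hC1pos ω).le α), Pi.add_apply]
        rcases le_total (C 0 ω) 1 with h | h
        · linarith [Real.rpow_le_one (hC1pos ω).le h hα, Real.rpow_nonneg (hC1pos ω).le β]
        · linarith [Real.rpow_le_rpow_of_exponent_le h hβ.le]
  have hterm {i : Fin (n + 1)} (hi : i ≠ 0) (ω : Ω) :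
      |C i ω * orderStat X i ω| ≤ max (Ct ω) 1 * Z ω := by
    have hos : 0 ≤ orderStat X i ω := (orderStat_eq_sort X i ω).symm ▸ (hXpos _ ω).le
    have hC : |C i ω| ≤ Ct ω := by
      rw [hCt]
      exact (by simp [hi] : |C i ω| = _).le.trans
        (le_ciSup (f := fun i : Fin (n + 1) => if i = 0 then 0 else |C i ω|)
          (Finite.bddAbove_range _) i)
    rw [abs_mul, abs_of_nonneg hos]
    exact mul_le_mul (hC.trans (le_max_left _ _)) (orderStat_le_iSup_min X hi ω) hos
      ((hCt0 ω).trans (le_max_left _ _))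
  have hZ0 (ω : Ω) : 0 ≤ Z ω := Real.iSup_nonneg fun p => by
    split_ifs
    exacts [(lt_min (hXpos _ ω) (hXpos _ ω)).le, le_rfl]
  have hDZ0 (ω : Ω) : 0 ≤ max (Ct ω) 1 * Z ω :=
    mul_nonneg ((hCt0 ω).trans (le_max_left _ _)) (hZ0 ω)
  have hnum := tendsto_measureReal_add_div (S := fun ω =>
      ∑ i ∈ Finset.univ.filter (fun i : Fin (n + 1) => (i : ℕ) < k), C i ω * orderStat X i ω)
    hF0 hpos hreg (R := fun ω => D ω * Z ω) (fun ω => by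
      rw [← Finset.sum_erase_eq_sub (by simpa using Nat.succ_le_iff.1 hk : (0 : Fin (n + 1)) ∈ _), mul_assoc]
      refine (Finset.abs_sum_le_sum_abs _ _).trans ((Finset.sum_le_card_nsmul _ _ _ fun i hi =>
        hterm (Finset.ne_of_mem_erase hi) ω).trans ?_)
      rw [nsmul_eq_mul]
      refine mul_le_mul_of_nonneg_right ?_ (hDZ0 ω)
      exact_mod_cast (Finset.card_le_univ _).trans_eq (Fintype.card_fin _)) hCM hDZ
  have hden : Tendsto (fun t => ∑ i : Fin (n + 1),
      (ℙ : Measure Ω).real {ω | C i ω * orderStat X i ω > t} /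
        (ℙ : Measure Ω).real {ω | X 0 ω > t}) atTop
      (nhds (∑ i : Fin (n + 1), if i = 0 then L else 0)) := by
    refine tendsto_finsetSum _ fun i _ => ?_
    split_ifs with hi
    · simpa only [hi, orderStat_zero] using hCM
    · refine squeeze_zero (fun t => div_nonneg measureReal_nonneg (hF0 t)) (fun t => ?_) hDZ
      refine div_le_div_of_nonneg_right (measureReal_mono fun ω hω => ?_) (hF0 t)
      refine lt_of_lt_of_le hω (((le_abs_self _).trans (hterm hi ω)).trans ?_)
      rw [hD, mul_assoc]
      exact le_mul_of_one_le_left (hDZ0 ω) (by simp)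
  rw [Finset.sum_ite_eq' Finset.univ (0 : Fin (n + 1)) fun _ => L, if_pos (Finset.mem_univ _)] at hden
  have hratio := hnum.div hden hLpos.ne'
  rw [div_self hLpos.ne'] at hratio
  refine hratio.congr' ?_
  filter_upwards [hpos] with t ht
  rw [Pi.div_apply, ← Finset.sum_div, div_div_div_cancel_right₀ ht.ne']
  rfl
end

section
/- Let X_1,...,X_n be positive random variables such that X_1 is regularly varying with index -α for some α>0, lim_{t→∞} P(X_i>t)/P(X_1>t)=λ_i ∈ [0,∞) for each i (so λ_1=1), and P(X_i>t, X_j>t)=o(P(X_1>t)) for all 1≤i<j≤n. Let C_1>0 be a random variable independent of the maximum X_{1,n}=max(X_1,...,X_n) with E[C_1^β]<∞ for some β>α. Then lim_{t→∞} P(C_1 X_{1,n} > t)/P(X_1>t) = E[C_1^α]·Σ_{i=1}^n λ_i. -/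
open MeasureTheory ProbabilityTheory Filter Real

/-- A Bonferroni lower bound for the measure of a finite union. -/
theorem sum_measureReal_le_measureReal_iUnion_add {Ω ι : Type*} [MeasurableSpace Ω] [Fintype ι]
    [DecidableEq ι] (μ : Measure Ω) [IsFiniteMeasure μ] (A : ι → Set Ω)
    (hA : ∀ i, MeasurableSet (A i)) :
    ∑ i, μ.real (A i) ≤
      μ.real (⋃ i, A i) + ∑ i, ∑ j ∈ Finset.univ.erase i, μ.real (A i ∩ A j) := by
  set B : ι → Set Ω := fun i => A i \ ⋃ j ∈ Finset.univ.erase i, A j with hB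
  have hBmeas : ∀ i, MeasurableSet (B i) := fun i =>
    (hA i).diff (Finset.measurableSet_biUnion _ fun j _ => hA j)
  have hdisj : Pairwise (Function.onFun Disjoint B) := by
    intro i j hij
    refine Set.disjoint_left.2 fun ω hi hj => hi.2 ?_
    exact Set.mem_biUnion (Finset.mem_coe.2 (Finset.mem_erase.2 ⟨hij.symm, Finset.mem_univ j⟩)) hj.1
  have hsum : ∑ i, μ.real (B i) ≤ μ.real (⋃ i, A i) := by
    rw [← measureReal_iUnion_fintype hdisj hBmeas]
    exact measureReal_mono (Set.iUnion_mono fun i => Set.sdiff_subset)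
  have hle : ∀ i, μ.real (A i) ≤
      μ.real (B i) + ∑ j ∈ Finset.univ.erase i, μ.real (A i ∩ A j) := by
    intro i
    have hsub : A i ⊆ B i ∪ ⋃ j ∈ Finset.univ.erase i, A i ∩ A j := by
      intro ω hω
      by_cases h : ω ∈ ⋃ j ∈ Finset.univ.erase i, A j
      · right
        simp only [Set.mem_iUnion] at h ⊢
        obtain ⟨j, hj, hωj⟩ := h
        exact ⟨j, hj, hω, hωj⟩
      · exact Or.inl ⟨hω, h⟩
    calc μ.real (A i) ≤ μ.real (B i ∪ ⋃ j ∈ Finset.univ.erase i, A i ∩ A j) :=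
          measureReal_mono hsub
      _ ≤ μ.real (B i) + μ.real (⋃ j ∈ Finset.univ.erase i, A i ∩ A j) :=
          measureReal_union_le _ _
      _ ≤ _ := by gcongr; exact measureReal_biUnion_finset_le _ _
  calc ∑ i, μ.real (A i)
      ≤ ∑ i, (μ.real (B i) + ∑ j ∈ Finset.univ.erase i, μ.real (A i ∩ A j)) :=
        Finset.sum_le_sum fun i _ => hle i
    _ ≤ _ := by rw [Finset.sum_add_distrib]; gcongr

/-- If all tails are comparable to `F` and joint exceedances are negligible with respect to `F`,
then the tail of the maximum is asymptotic to the sum of the individual tails. -/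
theorem tendsto_tail_iSup_div {Ω ι : Type*} [MeasurableSpace Ω] [Fintype ι] [Nonempty ι]
    (μ : Measure Ω) [IsFiniteMeasure μ] (X : ι → Ω → ℝ) (hX : ∀ i, Measurable (X i))
    (F : ℝ → ℝ) (hF : ∀ t, 0 ≤ F t) (lam : ι → ℝ)
    (hlam : ∀ i, Tendsto (fun t => μ.real {ω | t < X i ω} / F t) atTop (nhds (lam i)))
    (hjoint : ∀ i j, i ≠ j →
      Tendsto (fun t => μ.real {ω | t < X i ω ∧ t < X j ω} / F t) atTop (nhds 0)) :
    Tendsto (fun t => μ.real {ω | t < ⨆ i, X i ω} / F t) atTop (nhds (∑ i, lam i)) := by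
  classical
  have hunion : ∀ t, {ω | t < ⨆ i, X i ω} = ⋃ i, {ω | t < X i ω} := by
    intro t
    ext ω
    simp only [Set.mem_ofPred_eq, Set.mem_iUnion]
    exact lt_ciSup_iff (Set.finite_range _).bddAbove
  have hup : Tendsto (fun t => ∑ i, μ.real {ω | t < X i ω} / F t) atTop (nhds (∑ i, lam i)) :=
    tendsto_finsetSum _ fun i _ => hlam i
  have hpair : Tendsto (fun t => ∑ i, ∑ j ∈ Finset.univ.erase i,
      μ.real {ω | t < X i ω ∧ t < X j ω} / F t) atTop (nhds 0) := by
    have := tendsto_finsetSum (Finset.univ : Finset ι) fun i _ =>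
      tendsto_finsetSum (Finset.univ.erase i) fun j hj =>
        hjoint i j (Finset.ne_of_mem_erase hj).symm
    simpa using this
  have hlow := hup.sub hpair
  rw [sub_zero] at hlow
  refine tendsto_of_tendsto_of_tendsto_of_le_of_le hlow hup (fun t => ?_) (fun t => ?_)
  · have h := sum_measureReal_le_measureReal_iUnion_add μ (fun i => {ω | t < X i ω})
      fun i => measurableSet_lt measurable_const (hX i)
    simp only [← Finset.sum_div, ← sub_div, hunion t]
    refine div_le_div_of_nonneg_right ?_ (hF t)
    rw [sub_le_iff_le_add]
    exact h
  · simp only [← Finset.sum_div, hunion t]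
    exact div_le_div_of_nonneg_right (measureReal_iUnion_fintype_le _) (hF t)

/-- A Potter-type bound obtained from a one-step doubling inequality. -/
theorem potter_bound_of_doubling {F : ℝ → ℝ} (hF : Antitone F) (hF0 : ∀ t, 0 ≤ F t)
    {β t₀ : ℝ} (hβ : 0 ≤ β) (ht₀ : 0 < t₀)
    (hdouble : ∀ t, t₀ ≤ t → F t ≤ 2 ^ β * F (t * 2)) {s t : ℝ} (hs : t₀ ≤ s) (hst : s ≤ t) :
    F s ≤ 2 ^ β * (t / s) ^ β * F t := by
  have hs0 : 0 < s := ht₀.trans_le hs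
  have iter : ∀ k : ℕ, F s ≤ ((2 : ℝ) ^ k) ^ β * F (s * 2 ^ k) := by
    intro k
    induction k with
    | zero => simp
    | succ k ih =>
      have h1 : t₀ ≤ s * 2 ^ k :=
        hs.trans (le_mul_of_one_le_right hs0.le (one_le_pow₀ one_le_two))
      calc F s ≤ ((2 : ℝ) ^ k) ^ β * F (s * 2 ^ k) := ih
        _ ≤ ((2 : ℝ) ^ k) ^ β * (2 ^ β * F (s * 2 ^ k * 2)) := by
            gcongr; exact hdouble _ h1
        _ = _ := by
            rw [pow_succ, mul_rpow (by positivity) (by positivity), mul_assoc, mul_assoc]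
  have h1 : 1 ≤ t / s := (one_le_div hs0).2 hst
  obtain ⟨k, hk1, hk2⟩ := exists_nat_pow_near h1 one_lt_two
  have hlt : t ≤ s * 2 ^ (k + 1) := by
    rw [div_lt_iff₀ hs0] at hk2
    linarith
  calc F s ≤ ((2 : ℝ) ^ (k + 1)) ^ β * F (s * 2 ^ (k + 1)) := iter _
    _ ≤ (2 * (t / s)) ^ β * F t := by
        have h2 : (2 : ℝ) ^ (k + 1) ≤ 2 * (t / s) := by rw [pow_succ]; linarith
        exact mul_le_mul (rpow_le_rpow (by positivity) h2 hβ) (hF hlt) (hF0 _) (by positivity)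
    _ = _ := by rw [mul_rpow (by positivity) (by positivity)]

/-- The tail of a product of independent variables is a mixture of tails. -/
theorem measureReal_mul_gt_eq_integral_s11 {Ω : Type*} [MeasurableSpace Ω] (μ : Measure Ω)
    [IsProbabilityMeasure μ] {C M : Ω → ℝ} (hC : Measurable C) (hM : Measurable M)
    (hpos : ∀ ω, 0 < C ω) (hindep : IndepFun C M μ) (t : ℝ) :
    μ.real {ω | t < C ω * M ω} = ∫ ω, μ.real {ω' | t / C ω < M ω'} ∂μ := by
  have hS : MeasurableSet {p : ℝ × ℝ | t < p.1 * p.2} :=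
    measurableSet_lt measurable_const (measurable_fst.mul measurable_snd)
  have := Measure.isProbabilityMeasure_map (μ := μ) hM.aemeasurable
  have hslice : ∀ ω, μ.map M (Prod.mk (C ω) ⁻¹' {p : ℝ × ℝ | t < p.1 * p.2}) =
      μ {ω' | t / C ω < M ω'} := by
    intro ω
    rw [Measure.map_apply hM (measurable_prodMk_left hS)]
    congr 1
    ext ω'
    simp only [Set.mem_preimage, Set.mem_ofPred_eq]
    rw [div_lt_iff₀ (hpos ω), mul_comm]
  have hmeas : Measurable fun ω => μ {ω' | t / C ω < M ω'} := by
    simp_rw [← hslice]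
    exact (measurable_measure_prodMk_left hS).comp hC
  have hprod : μ {ω | t < C ω * M ω} = ∫⁻ ω, μ {ω' | t / C ω < M ω'} ∂μ := by
    have h1 : μ {ω | t < C ω * M ω} =
        μ.map (fun ω => (C ω, M ω)) {p : ℝ × ℝ | t < p.1 * p.2} := by
      rw [Measure.map_apply (hC.prodMk hM) hS]
      rfl
    rw [h1, (indepFun_iff_map_prod_eq_prod_map_map hC.aemeasurable hM.aemeasurable).1 hindep,
      Measure.prod_apply hS, lintegral_map (measurable_measure_prodMk_left hS) hC]
    exact lintegral_congr hslice
  simp only [Measure.real]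
  rw [hprod, integral_toReal hmeas.aemeasurable (ae_of_all _ fun ω => measure_lt_top _ _)]

/-- Breiman's lemma for a tail `G` asymptotic to a multiple of a regularly varying tail `F`. -/
theorem tendsto_integral_tail_div {Ω : Type*} [MeasurableSpace Ω] (μ : Measure Ω)
    [IsProbabilityMeasure μ] {F G : ℝ → ℝ} {α β L : ℝ} (hα : 0 < α) (hβ : α < β)
    (hF : Antitone F) (hF0 : ∀ t, 0 ≤ F t)
    (hG : Antitone G) (hG0 : ∀ t, 0 ≤ G t) (hG1 : ∀ t, G t ≤ 1)
    (hreg : ∀ x : ℝ, 0 < x → Tendsto (fun t => F (t * x) / F t) atTop (nhds (x ^ (-α))))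
    (hGF : Tendsto (fun t => G t / F t) atTop (nhds L))
    {C : Ω → ℝ} (hC : Measurable C) (hpos : ∀ ω, 0 < C ω)
    (hmom : Integrable (fun ω => C ω ^ β) μ) :
    Tendsto (fun t => (∫ ω, G (t / C ω) ∂μ) / F t) atTop (nhds ((∫ ω, C ω ^ α ∂μ) * L)) := by
  have hFpos : ∀ t, 0 < F t := by
    intro t
    refine (hF0 t).lt_of_ne fun h0 => ?_
    have hev : ∀ᶠ s in atTop, F (s * 1) / F s = 0 := by
      filter_upwards [eventually_ge_atTop t] with s hs
      rw [le_antisymm ((hF hs).trans h0.ge) (hF0 s), div_zero]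
    have h1 := tendsto_nhds_unique (hreg 1 one_pos)
      (tendsto_const_nhds.congr' (hev.mono fun _ h => h.symm))
    simp at h1
  have hβ0 : 0 < β := hα.trans hβ
  have hdouble : ∀ᶠ t in atTop, F t ≤ 2 ^ β * F (t * 2) := by
    have hlt : (2 : ℝ) ^ (-β) < 2 ^ (-α) := rpow_lt_rpow_of_exponent_lt one_lt_two (by linarith)
    filter_upwards [(hreg 2 two_pos).eventually (lt_mem_nhds hlt)] with t ht
    rw [lt_div_iff₀ (hFpos t), rpow_neg zero_le_two, inv_mul_lt_iff₀ (by positivity)] at ht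
    exact ht.le
  have hGF1 : ∀ᶠ t in atTop, G t ≤ (L + 1) * F t := by
    filter_upwards [hGF.eventually (gt_mem_nhds (lt_add_one L))] with t ht
    exact ((div_lt_iff₀ (hFpos t)).1 ht).le
  obtain ⟨t₁, ht₁⟩ := eventually_atTop.1 (hdouble.and hGF1)
  obtain ⟨t₀, ht₀, ht₀1⟩ : ∃ t₀ : ℝ, 0 < t₀ ∧ t₁ ≤ t₀ :=
    ⟨max t₁ 1, by positivity, le_max_left _ _⟩
  have hd : ∀ t, t₀ ≤ t → F t ≤ 2 ^ β * F (t * 2) := fun t ht => (ht₁ t (ht₀1.trans ht)).1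
  have hg : ∀ t, t₀ ≤ t → G t ≤ (L + 1) * F t := fun t ht => (ht₁ t (ht₀1.trans ht)).2
  have hL : 0 ≤ L := ge_of_tendsto' hGF fun t => div_nonneg (hG0 t) (hF0 t)
  set K : ℝ := (L + 1) * 2 ^ β + 2 ^ β / F t₀ with hK
  have hpot : ∀ {s t : ℝ}, t₀ ≤ s → s ≤ t → F s ≤ 2 ^ β * (t / s) ^ β * F t :=
    fun hs hst => potter_bound_of_doubling hF hF0 hβ0.le ht₀ hd hs hst
  have hdom : ∀ t, t₀ ≤ t → ∀ c, 0 < c → G (t / c) / F t ≤ (L + 1) + K * c ^ β := by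
    intro t ht c hc
    have ht0 : 0 < t := ht₀.trans_le ht
    have hcβ : 0 < c ^ β := rpow_pos_of_pos hc β
    have h2β : (0 : ℝ) < 2 ^ β := by positivity
    have hF₀ := hFpos t₀
    have hK1 : (L + 1) * 2 ^ β ≤ K := le_add_of_nonneg_right (by positivity)
    have hK2 : 2 ^ β / F t₀ ≤ K := le_add_of_nonneg_left (by positivity)
    have hKc : 0 ≤ K * c ^ β := by positivity
    rw [div_le_iff₀ (hFpos t)]
    rcases lt_or_ge (t / c) t₀ with hs | hs
    · have htc : t / t₀ ≤ c := by
        rw [div_lt_iff₀ hc] at hs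
        rw [div_le_iff₀ ht₀]
        linarith
      have h1 : F t₀ ≤ 2 ^ β * c ^ β * F t := by
        refine (hpot le_rfl ht).trans ?_
        have := hF0 t
        gcongr
      calc G (t / c) ≤ 1 := hG1 _
        _ ≤ 2 ^ β * c ^ β * F t / F t₀ := (one_le_div hF₀).2 h1
        _ = 2 ^ β / F t₀ * c ^ β * F t := by ring
        _ ≤ K * c ^ β * F t := by have := hF0 t; gcongr
        _ ≤ _ := mul_le_mul_of_nonneg_right (by linarith) (hF0 t)
    · refine (hg _ hs).trans ?_
      rcases le_total (t / c) t with hst | hst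
      · have h1 := hpot hs hst
        rw [div_div_cancel₀ ht0.ne'] at h1
        calc (L + 1) * F (t / c) ≤ (L + 1) * (2 ^ β * c ^ β * F t) := by gcongr
          _ = (L + 1) * 2 ^ β * c ^ β * F t := by ring
          _ ≤ K * c ^ β * F t := by have := hF0 t; gcongr
          _ ≤ _ := mul_le_mul_of_nonneg_right (by linarith) (hF0 t)
      · calc (L + 1) * F (t / c) ≤ (L + 1) * F t := by gcongr; exact hF hst
          _ ≤ _ := mul_le_mul_of_nonneg_right (by linarith) (hF0 t)
  have hlim : ∀ c, 0 < c → Tendsto (fun t => G (t / c) / F t) atTop (nhds (c ^ α * L)) := by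
    intro c hc
    have h1 := hreg c⁻¹ (inv_pos.2 hc)
    rw [inv_rpow hc.le, rpow_neg hc.le, inv_inv] at h1
    have h2 := hGF.comp (tendsto_id.atTop_div_const hc)
    refine (h1.mul h2).congr fun t => ?_
    have := (hFpos (t / c)).ne'
    simp only [Function.comp_apply, id_eq, ← div_eq_mul_inv]
    field_simp
  simp_rw [← integral_div]
  rw [← integral_mul_const]
  refine tendsto_integral_filter_of_dominated_convergence
    (fun ω => (L + 1) + K * C ω ^ β) (Eventually.of_forall fun t => ?_) ?_
    ((integrable_const _).add (hmom.const_mul K)) (ae_of_all _ fun ω => hlim _ (hpos ω))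
  · exact ((hG.measurable.comp (measurable_const.div hC)).div_const _).aestronglyMeasurable
  · filter_upwards [eventually_ge_atTop t₀] with t ht
    refine ae_of_all _ fun ω => ?_
    rw [norm_of_nonneg (div_nonneg (hG0 _) (hF0 _))]
    exact hdom t ht _ (hpos ω)

/-- Breiman-type result: under regular variation of `X_1`, tail equivalence of the
`X_i`, negligible joint tails and a moment condition on `C₁` (independent of the
maximum), `P(C₁·max_i X_i > t)/P(X_1 > t) → E[C₁^α]·∑ λ_i`. -/
theorem scaled_max_tail_limit
    {Ω : Type*} [MeasureSpace Ω] [IsProbabilityMeasure (ℙ : Measure Ω)]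
    (n : ℕ) (X : Fin (n + 1) → Ω → ℝ) (hXmeas : ∀ i, Measurable (X i))
    (hXpos : ∀ i ω, 0 < X i ω)
    (α : ℝ) (hα : 0 < α)
    (hreg : ∀ x : ℝ, 0 < x →
      Tendsto (fun t : ℝ =>
        (ℙ {ω | X 0 ω > t * x}).toReal / (ℙ {ω | X 0 ω > t}).toReal) atTop (nhds (x ^ (-α))))
    (lam : Fin (n + 1) → ℝ) (hlam_nonneg : ∀ i, 0 ≤ lam i) (hlam0 : lam 0 = 1)
    (hlam : ∀ i, Tendsto (fun t : ℝ =>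
        (ℙ {ω | X i ω > t}).toReal / (ℙ {ω | X 0 ω > t}).toReal) atTop (nhds (lam i)))
    (hjoint : ∀ i j : Fin (n + 1), i < j →
      Tendsto (fun t : ℝ =>
        (ℙ {ω | X i ω > t ∧ X j ω > t}).toReal / (ℙ {ω | X 0 ω > t}).toReal)
        atTop (nhds 0))
    (C₁ : Ω → ℝ) (hCmeas : Measurable C₁) (hCpos : ∀ ω, 0 < C₁ ω)
    (hindep : IndepFun C₁ (fun ω => ⨆ i, X i ω) ℙ)
    (β : ℝ) (hβ : α < β)
    (hmom : Integrable (fun ω => C₁ ω ^ β) ℙ) :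
    Tendsto (fun t : ℝ =>
        (ℙ {ω | C₁ ω * (⨆ i, X i ω) > t}).toReal / (ℙ {ω | X 0 ω > t}).toReal)
      atTop (nhds ((∫ ω, C₁ ω ^ α ∂ℙ) * ∑ i, lam i)) := by
  have hanti : ∀ Y : Ω → ℝ, Antitone fun t => (ℙ : Measure Ω).real {ω | t < Y ω} :=
    fun Y s t hst => measureReal_mono fun ω (hω : t < Y ω) => hst.trans_lt hω
  have hMmeas : Measurable fun ω => ⨆ i, X i ω := Measurable.iSup hXmeas
  have hmax : Tendsto (fun t => (ℙ : Measure Ω).real {ω | t < ⨆ i, X i ω} /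
      (ℙ : Measure Ω).real {ω | t < X 0 ω}) atTop (nhds (∑ i, lam i)) := by
    refine tendsto_tail_iSup_div ℙ X hXmeas _ (fun _ => measureReal_nonneg) lam hlam ?_
    intro i j hij
    rcases lt_or_gt_of_ne hij with h | h
    · exact hjoint i j h
    · simp_rw [and_comm (a := _ < X i _)]
      exact hjoint j i h
  have key := tendsto_integral_tail_div ℙ hα hβ (hanti (X 0)) (fun _ => measureReal_nonneg)
    (hanti fun ω => ⨆ i, X i ω) (fun _ => measureReal_nonneg) (fun _ => measureReal_le_one)
    hreg hmax hCmeas hCpos hmom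
  refine key.congr fun t => ?_
  rw [← measureReal_mul_gt_eq_integral_s11 ℙ hCmeas hMmeas hCpos hindep t]
  rfl
end
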